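/- The distributed language NONTRIVIAL-AUTOMORPHISM, consisting of all configurations (G,x) with trivial (empty) input x such that the graph G admits an automorphism different from the identity (i.e., a bijection φ : V(G) → V(G), φ ≠ id, with {u,v} ∈ E(G) ⟺ {φ(u),φ(v)} ∈ E(G) for all nodes u, v), is in Λ_3. -/

import Mathlib

/-!
Distributed decision in the LOCAL model: configurations, local algorithms,
the local hierarchy Σ_k / Π_k / Λ_k and co-Λ_k.
-/

/-- A configuration: a finite connected simple graph on `Fin n` (with `n ≥ 1`)
together with an input bit string at each node. -/
structure Config where
  n : ℕ
  npos : 0 < n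
  G : SimpleGraph (Fin n)
  conn : G.Connected
  x : Fin n → List Bool

/-- The ball of radius `t` around `v`: all nodes at distance at most `t`. -/
def ball (C : Config) (v : Fin C.n) (t : ℕ) : Set (Fin C.n) :=
  {u | C.G.dist v u ≤ t}

lemma self_mem_ball (C : Config) (v : Fin C.n) (t : ℕ) : v ∈ ball C v t := by
  simp [ball, SimpleGraph.dist_self]

/-- A `t`-round local algorithm: at each node it outputs a bit, computed from the whole
configuration, identity assignment and labellings, subject to locality: the output at `v`
only depends on the ball of radius `t` around `v` together with the inputs, identities and
labellings on it (isomorphic labelled balls give equal outputs). -/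
structure LocalAlg where
  t : ℕ
  run : (C : Config) → (Fin C.n → ℕ) → (ℕ → Fin C.n → List Bool) → Fin C.n → Bool
  isLocal : ∀ (C C' : Config) (ident : Fin C.n → ℕ) (ident' : Fin C'.n → ℕ)
      (ℓ : ℕ → Fin C.n → List Bool) (ℓ' : ℕ → Fin C'.n → List Bool)
      (v : Fin C.n) (v' : Fin C'.n)
      (φ : (C.G.induce (ball C v t)) ≃g (C'.G.induce (ball C' v' t))),
      ((φ ⟨v, self_mem_ball C v t⟩).val = v') →
      (∀ u : ball C v t, C'.x (φ u).val = C.x u.val) →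
      (∀ u : ball C v t, ident' (φ u).val = ident u.val) →
      (∀ (i : ℕ) (u : ball C v t), ℓ' i (φ u).val = ℓ i u.val) →
      run C ident ℓ v = run C' ident' ℓ' v'

/-- A labelling of size `c · log₂ n`. -/
def goodLabel (c : ℕ) (C : Config) (ℓ : Fin C.n → List Bool) : Prop :=
  ∀ v, (ℓ v).length ≤ c * Nat.log 2 C.n

/-- Alternating quantification over `j` further labellings (stored at indices `i, i+1, …`),
starting with an existential quantifier when the `Bool` argument is `true` and with a
universal quantifier when it is `false`; `P` is the final predicate. -/
def altQ (c : ℕ) (C : Config) (P : (ℕ → Fin C.n → List Bool) → Prop) :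
    ℕ → ℕ → Bool → (ℕ → Fin C.n → List Bool) → Prop
  | 0, _, _, ℓs => P ℓs
  | j + 1, i, true, ℓs =>
      ∃ ℓ, goodLabel c C ℓ ∧ altQ c C P j (i + 1) false (Function.update ℓs i ℓ)
  | j + 1, i, false, ℓs =>
      ∀ ℓ, goodLabel c C ℓ → altQ c C P j (i + 1) true (Function.update ℓs i ℓ)

/-- Global acceptance: every node outputs 1. -/
def accepts (A : LocalAlg) (C : Config) (ident : Fin C.n → ℕ)
    (ℓs : ℕ → Fin C.n → List Bool) : Prop :=
  ∀ v, A.run C ident ℓs v = true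

/-- The empty collection of labellings. -/
def noLabels (C : Config) : ℕ → Fin C.n → List Bool := fun _ _ => []

/-- Inputs are bounded by `α · log₂ n` bits. -/
def BoundedInput (α : ℕ) (C : Config) : Prop :=
  ∀ v, (C.x v).length ≤ α * Nat.log 2 C.n

/-- An identity assignment: injective, with values in `{1, …, n^β}`. -/
def IsIdAssignment (β : ℕ) (C : Config) (ident : Fin C.n → ℕ) : Prop :=
  Function.Injective ident ∧ ∀ v, 1 ≤ ident v ∧ ident v ≤ C.n ^ β

/-- The class `Σ_k` (with input-size constant `α` and identity-space constant `β`):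
`(G,x) ∈ L ⟺ ∃ℓ₁ ∀ℓ₂ … Q ℓ_k`, `A` accepts, for every identity assignment. -/
def SigmaC (α β k : ℕ) (L : Set Config) : Prop :=
  ∃ (A : LocalAlg) (c : ℕ), ∀ C : Config, BoundedInput α C →
    ∀ ident : Fin C.n → ℕ, IsIdAssignment β C ident →
      (C ∈ L ↔ altQ c C (accepts A C ident) k 0 true (noLabels C))

/-- The class `Π_k`: as `Σ_k` but the alternation starts with a universal quantifier. -/
def PiC (α β k : ℕ) (L : Set Config) : Prop :=
  ∃ (A : LocalAlg) (c : ℕ), ∀ C : Config, BoundedInput α C →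
    ∀ ident : Fin C.n → ℕ, IsIdAssignment β C ident →
      (C ∈ L ↔ altQ c C (accepts A C ident) k 0 false (noLabels C))

/-- `Λ_k := Σ_k` for odd `k`, `Λ_k := Π_k` for even `k` (so `Λ_0 = LD`). -/
def LambdaC (α β k : ℕ) (L : Set Config) : Prop :=
  if k % 2 = 1 then SigmaC α β k L else PiC α β k L

/-- `co-Λ_k`: the complement (within the set of all configurations) is in `Λ_k`. -/
def coLambdaC (α β k : ℕ) (L : Set Config) : Prop :=
  LambdaC α β k ({C : Config | BoundedInput α C} \ L)

/-- Input-preserving isomorphism of configurations. -/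
def ConfigIso (C C' : Config) : Prop :=
  ∃ φ : C.G ≃g C'.G, ∀ v, C'.x (φ v) = C.x v

/-- A distributed language: a set of configurations (with bounded inputs)
closed under input-preserving isomorphism. -/
def IsDistLang (α : ℕ) (L : Set Config) : Prop :=
  (∀ C ∈ L, BoundedInput α C) ∧ ∀ C C', ConfigIso C C' → (C ∈ L ↔ C' ∈ L)

/-- The leading quantifier of `Λ_k`: existential iff `k` is odd. -/
def startEx (k : ℕ) : Bool := decide (k % 2 = 1)

/-- `NONTRIVIAL-AUTOMORPHISM`: configurations with trivial (empty) input whose graph admits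
an automorphism different from the identity. -/
def NTALang : Set Config :=
  {C | (∀ v, C.x v = []) ∧
    ∃ φ : Fin C.n ≃ Fin C.n, φ ≠ Equiv.refl (Fin C.n) ∧
      ∀ u v : Fin C.n, C.G.Adj u v ↔ C.G.Adj (φ u) (φ v)}

/-! ### Algorithms that inspect a node and the set of its neighbours -/

/-- The local data of a node: its input, its identity and its labels. -/
structure NodeData where
  /-- The input of the node. -/
  input : List Bool
  /-- The identity of the node. -/
  ident : ℕ
  /-- The labels of the node. -/
  label : ℕ → List Bool

/-- The local data of the node `v`. -/
def nodeData (C : Config) (ident : Fin C.n → ℕ) (ℓ : ℕ → Fin C.n → List Bool)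
    (v : Fin C.n) : NodeData :=
  ⟨C.x v, ident v, fun i => ℓ i v⟩

/-- The set of local data of the neighbours of `v`. -/
def nbrData (C : Config) (ident : Fin C.n → ℕ) (ℓ : ℕ → Fin C.n → List Bool)
    (v : Fin C.n) : Set NodeData :=
  nodeData C ident ℓ '' {w | C.G.Adj v w}

open Classical in
/-- The one-round algorithm whose output at `v` is determined by the data of `v` and the set of
data of the neighbours of `v`. -/
noncomputable def LocalAlg.ofNeighbors (R : NodeData → Set NodeData → Prop) : LocalAlg where
  t := 1
  run C ident ℓ v := decide (R (nodeData C ident ℓ v) (nbrData C ident ℓ v))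
  isLocal := by
    intro C C' ident ident' ℓ ℓ' v v' φ hv hx hid hℓ
    have hdata : ∀ u : ball C v 1,
        nodeData C' ident' ℓ' (φ u).val = nodeData C ident ℓ u.val := by
      intro u
      simp [nodeData, hx, hid, hℓ]
    have hnode : nodeData C' ident' ℓ' v' = nodeData C ident ℓ v := by
      rw [← hv]; exact hdata _
    have hnbr : nbrData C' ident' ℓ' v' = nbrData C ident ℓ v := by
      apply Set.Subset.antisymm
      · rintro _ ⟨w, hw, rfl⟩
        have hw' : C'.G.Adj v' w := hw
        have hwb : w ∈ ball C' v' 1 := (SimpleGraph.dist_eq_one_iff_adj.2 hw').le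
        obtain ⟨u, hu⟩ := φ.surjective ⟨w, hwb⟩
        refine ⟨u.val, ?_, ?_⟩
        · have h := φ.map_adj_iff (v := ⟨v, self_mem_ball C v 1⟩) (w := u)
          rw [hu] at h
          simp only [SimpleGraph.comap_adj, Function.Embedding.subtype_apply, hv] at h
          exact h.1 hw'
        · rw [← hdata u, hu]
      · rintro _ ⟨w, hw, rfl⟩
        have hw' : C.G.Adj v w := hw
        have hwb : w ∈ ball C v 1 := (SimpleGraph.dist_eq_one_iff_adj.2 hw').le
        refine ⟨(φ ⟨w, hwb⟩).val, ?_, hdata _⟩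
        have h := φ.map_adj_iff (v := ⟨v, self_mem_ball C v 1⟩) (w := ⟨w, hwb⟩)
        simp only [SimpleGraph.comap_adj, Function.Embedding.subtype_apply, hv] at h
        exact h.2 hw'
    rw [hnode, hnbr]

lemma accepts_ofNeighbors (R : NodeData → Set NodeData → Prop) (C : Config)
    (ident : Fin C.n → ℕ) (ℓ : ℕ → Fin C.n → List Bool) :
    accepts (LocalAlg.ofNeighbors R) C ident ℓ ↔
      ∀ v, R (nodeData C ident ℓ v) (nbrData C ident ℓ v) := by
  simp [accepts, LocalAlg.ofNeighbors]

/-! ### Binary encoding of numbers by labels -/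

/-- The number with the given binary digits, least significant first. -/
def decodeBits (l : List Bool) : ℕ :=
  l.foldr Nat.bit 0

lemma decodeBits_bits (m : ℕ) : decodeBits m.bits = m := by
  induction m using Nat.binaryRec' with
  | zero => simp [decodeBits]
  | bit b m h ih =>
    rw [Nat.bits_append_bit _ _ h]
    simpa [decodeBits] using congrArg (Nat.bit b) ih

lemma length_bits_le {m k : ℕ} (h : m < 2 ^ k) : m.bits.length ≤ k := by
  rw [Nat.size_eq_bits_len]
  exact Nat.size_le.2 h

lemma pair_lt_two_pow {a b k : ℕ} (ha : a < 2 ^ k) (hb : b < 2 ^ k) :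
    Nat.pair a b < 2 ^ (2 * k) := by
  refine (Nat.pair_lt_max_add_one_sq a b).trans_le ?_
  rw [mul_comm, pow_mul]
  exact Nat.pow_le_pow_left (Nat.succ_le_of_lt (max_lt ha hb)) 2

/-! ### Pointers towards a node of a connected graph -/

namespace SimpleGraph.Connected

variable {V : Type*} {G : SimpleGraph V}

lemma exists_adj_dist_lt (hG : G.Connected) {r u : V} (h : u ≠ r) :
    ∃ w, G.Adj u w ∧ G.dist w r < G.dist u r := by
  obtain ⟨p, hp⟩ := hG.exists_walk_length_eq_dist u r
  cases p with
  | nil => exact absurd rfl h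
  | cons hadj q =>
    refine ⟨_, hadj, ?_⟩
    have := G.dist_le q
    simp only [Walk.length_cons] at hp
    omega

lemma dist_lt_card [Fintype V] (hG : G.Connected) (u v : V) :
    G.dist u v < Fintype.card V := by
  obtain ⟨p, hp, hl⟩ := hG.exists_path_of_dist u v
  rw [← hl]
  exact hp.length_lt

lemma apply_eq_of_forall_adj {α : Type*} (hG : G.Connected) {f : V → α}
    (h : ∀ u v, G.Adj u v → f v = f u) (u v : V) : f u = f v := by
  obtain ⟨p⟩ := hG.preconnected u v
  induction p with
  | nil => rfl
  | cons hadj _ ih => rw [← h _ _ hadj, ih]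

end SimpleGraph.Connected

/-- A permutation of a finite vertex set that maps edges to edges also reflects edges. -/
lemma SimpleGraph.adj_of_adj_perm {V : Type*} [Finite V] {G : SimpleGraph V}
    {φ : Equiv.Perm V} (h : ∀ u v, G.Adj u v → G.Adj (φ u) (φ v)) {u v : V}
    (huv : G.Adj (φ u) (φ v)) : G.Adj u v := by
  have hpow : ∀ (k : ℕ) (u v : V), G.Adj u v → G.Adj ((φ ^ k) u) ((φ ^ k) v) := by
    intro k
    induction k with
    | zero => simp
    | succ k ih =>
      intro u v huv
      rw [pow_succ']
      exact h _ _ (ih u v huv)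
  obtain ⟨k, hk, hφ⟩ := (isOfFinOrder_of_finite φ).exists_pow_eq_one
  obtain ⟨k, rfl⟩ := Nat.exists_eq_succ_of_ne_zero hk.ne'
  have := hpow k _ _ huv
  simpa [← Equiv.Perm.mul_apply, ← pow_succ, hφ] using this

/-! ### The verifier

Label `0` encodes the identity of the image of a node under the alleged automorphism. Label `1`
encodes a refutation of that claim: a global triple `(tag, a, b)` and the depth of the node in a
spanning tree whose root witnesses the error. Label `2` encodes the depth of the node in a spanning
forest whose roots witness an error in the refutation. -/

namespace NodeData

/-- The identity of the alleged image of a node. -/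
def image (p : NodeData) : ℕ := decodeBits (p.label 0)

/-- The depth of a node in the tree of the refutation. -/
def depth (p : NodeData) : ℕ := (Nat.unpair (decodeBits (p.label 1))).1

/-- The encoded triple of the refutation. -/
def claim (p : NodeData) : ℕ := (Nat.unpair (decodeBits (p.label 1))).2

/-- The depth of a node in the forest rooted at the errors of the refutation. -/
def level (p : NodeData) : ℕ := decodeBits (p.label 2)

end NodeData

/-- Encoding of a triple by a number. -/
def encodeClaim (tag a b : ℕ) : ℕ := Nat.pair tag (Nat.pair a b)

/-- The meaning of a refutation at a node: tag `0` says that the map is the identity, tag `1` that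
the identity `a` is not attained, tag `2` that some edge with image identities `a`, `b` is
mapped to a non-edge. -/
def LocalClaim (tag a b : ℕ) (p : NodeData) (S : Set NodeData) : Prop :=
  (tag = 0 → p.image = p.ident) ∧
  (tag = 1 → p.image ≠ a ∧ (p.depth = 0 → p.ident = a)) ∧
  (2 ≤ tag → ¬ (p.ident = a ∧ ∃ q ∈ S, q.ident = b) ∧
    (p.depth = 0 → p.image = a ∧ ∃ q ∈ S, q.image = b))

/-- A node finds no error in the refutation. -/
def Refutes (p : NodeData) (S : Set NodeData) : Prop :=
  (∀ q ∈ S, q.claim = p.claim) ∧ (p.depth = 0 ∨ ∃ q ∈ S, q.depth < p.depth) ∧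
    LocalClaim p.claim.unpair.1 p.claim.unpair.2.unpair.1 p.claim.unpair.2.unpair.2 p S

/-- The acceptance condition of the verifier for nontrivial automorphisms. -/
def Verifies (p : NodeData) (S : Set NodeData) : Prop :=
  p.input = [] ∧ S.Nonempty ∧ ((p.level = 0 ∧ ¬ Refutes p S) ∨ ∃ q ∈ S, q.level < p.level)

/-- The labellings of the verifier. -/
def labels (C : Config) (ℓ₁ ℓ₂ ℓ₃ : Fin C.n → List Bool) : ℕ → Fin C.n → List Bool :=
  Function.update (Function.update (Function.update (noLabels C) 0 ℓ₁) 1 ℓ₂) 2 ℓ₃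

section Labels

variable (C : Config) (ident : Fin C.n → ℕ) (ℓ₁ ℓ₂ ℓ₃ : Fin C.n → List Bool) (v : Fin C.n)

@[simp] lemma nodeData_ident : (nodeData C ident (labels C ℓ₁ ℓ₂ ℓ₃) v).ident = ident v := rfl

@[simp] lemma nodeData_image :
    (nodeData C ident (labels C ℓ₁ ℓ₂ ℓ₃) v).image = decodeBits (ℓ₁ v) := by
  simp [nodeData, NodeData.image, labels, Function.update]

@[simp] lemma nodeData_depth :
    (nodeData C ident (labels C ℓ₁ ℓ₂ ℓ₃) v).depth = (decodeBits (ℓ₂ v)).unpair.1 := by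
  simp [nodeData, NodeData.depth, labels, Function.update]

@[simp] lemma nodeData_claim :
    (nodeData C ident (labels C ℓ₁ ℓ₂ ℓ₃) v).claim = (decodeBits (ℓ₂ v)).unpair.2 := by
  simp [nodeData, NodeData.claim, labels, Function.update]

@[simp] lemma nodeData_level :
    (nodeData C ident (labels C ℓ₁ ℓ₂ ℓ₃) v).level = decodeBits (ℓ₃ v) := by
  simp [nodeData, NodeData.level, labels, Function.update]

@[simp] lemma exists_mem_nbrData {ℓ : ℕ → Fin C.n → List Bool} {P : NodeData → Prop} :
    (∃ q ∈ nbrData C ident ℓ v, P q) ↔ ∃ w, C.G.Adj v w ∧ P (nodeData C ident ℓ w) := by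
  simp [nbrData]

@[simp] lemma forall_mem_nbrData {ℓ : ℕ → Fin C.n → List Bool} {P : NodeData → Prop} :
    (∀ q ∈ nbrData C ident ℓ v, P q) ↔ ∀ w, C.G.Adj v w → P (nodeData C ident ℓ w) := by
  simp [nbrData]

@[simp] lemma nbrData_nonempty {ℓ : ℕ → Fin C.n → List Bool} :
    (nbrData C ident ℓ v).Nonempty ↔ ∃ w, C.G.Adj v w := by
  simp [nbrData, Set.Nonempty]

end Labels

lemma altQ_three_ofNeighbors (c : ℕ) (C : Config) (ident : Fin C.n → ℕ)
    (R : NodeData → Set NodeData → Prop) :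
    altQ c C (accepts (LocalAlg.ofNeighbors R) C ident) 3 0 true (noLabels C) ↔
      ∃ ℓ₁, goodLabel c C ℓ₁ ∧ ∀ ℓ₂, goodLabel c C ℓ₂ → ∃ ℓ₃, goodLabel c C ℓ₃ ∧
        ∀ v, R (nodeData C ident (labels C ℓ₁ ℓ₂ ℓ₃) v)
          (nbrData C ident (labels C ℓ₁ ℓ₂ ℓ₃) v) := by
  simp only [altQ, accepts_ofNeighbors, labels]

/-- Whether a node finds an error in a refutation does not depend on the last labelling. -/
lemma refutes_congr {C : Config} {ident : Fin C.n → ℕ} {ℓ₁ ℓ₂ ℓ₃ ℓ₃' : Fin C.n → List Bool}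
    {v : Fin C.n} :
    Refutes (nodeData C ident (labels C ℓ₁ ℓ₂ ℓ₃) v) (nbrData C ident (labels C ℓ₁ ℓ₂ ℓ₃) v) ↔
    Refutes (nodeData C ident (labels C ℓ₁ ℓ₂ ℓ₃') v)
      (nbrData C ident (labels C ℓ₁ ℓ₂ ℓ₃') v) := by
  simp [Refutes, LocalClaim]

section Bounds

variable {C : Config} {β : ℕ} {ident : Fin C.n → ℕ}

lemma card_lt_two_pow (hn : 2 ≤ C.n) : C.n < 2 ^ (2 * Nat.log 2 C.n) := by
  have hlog : 1 ≤ Nat.log 2 C.n := Nat.log_pos one_lt_two hn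
  refine (Nat.lt_pow_succ_log_self one_lt_two C.n).trans_le ?_
  exact Nat.pow_le_pow_right (by norm_num) (by omega)

lemma ident_lt_two_pow (hn : 2 ≤ C.n) (hβ : 1 ≤ β) (hid : IsIdAssignment β C ident)
    (v : Fin C.n) : ident v < 2 ^ (2 * β * Nat.log 2 C.n) := by
  refine (hid.2 v).2.trans_lt ?_
  have h := Nat.pow_lt_pow_left (card_lt_two_pow hn) (n := β) (by omega)
  rw [← pow_mul] at h
  rwa [mul_right_comm]

lemma dist_lt_two_pow (hn : 2 ≤ C.n) (hβ : 1 ≤ β) (u v : Fin C.n) :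
    C.G.dist u v < 2 ^ (2 * β * Nat.log 2 C.n) := by
  have h := C.conn.dist_lt_card u v
  rw [Fintype.card_fin] at h
  refine (h.trans (card_lt_two_pow hn)).trans_le (Nat.pow_le_pow_right (by norm_num) ?_)
  exact Nat.mul_le_mul_right _ (by omega)

lemma goodLabel_bits_of_lt {f : Fin C.n → ℕ} {c : ℕ}
    (h : ∀ v, f v < 2 ^ (c * Nat.log 2 C.n)) : goodLabel c C fun v => (f v).bits :=
  fun v => length_bits_le (h v)

lemma goodLabel_mono {c c' : ℕ} (h : c ≤ c') {ℓ : Fin C.n → List Bool} (hℓ : goodLabel c C ℓ) :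
    goodLabel c' C ℓ :=
  fun v => (hℓ v).trans (Nat.mul_le_mul_right _ h)

/-- The labelling encoding a refutation with triple `(tag, a, b)` and root `r`. -/
noncomputable def refutation (C : Config) (tag a b : ℕ) (r : Fin C.n) : Fin C.n → List Bool :=
  fun v => (Nat.pair (C.G.dist v r) (encodeClaim tag a b)).bits

lemma goodLabel_refutation (hn : 2 ≤ C.n) (hβ : 1 ≤ β) {tag a b : ℕ} (htag : tag ≤ 2)
    (ha : a < 2 ^ (2 * β * Nat.log 2 C.n)) (hb : b < 2 ^ (2 * β * Nat.log 2 C.n))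
    (r : Fin C.n) : goodLabel (16 * β) C (refutation C tag a b r) := by
  have hlog : 1 ≤ Nat.log 2 C.n := Nat.log_pos one_lt_two hn
  have hpos : 1 ≤ β * Nat.log 2 C.n := Nat.mul_pos hβ hlog
  have htag' : tag < 2 ^ (2 * (2 * β * Nat.log 2 C.n)) :=
    calc tag < 2 ^ 2 := by omega
      _ ≤ _ := Nat.pow_le_pow_right (by norm_num) (by nlinarith)
  refine goodLabel_bits_of_lt fun v => ?_
  have hd : C.G.dist v r < 2 ^ (2 * (2 * (2 * β * Nat.log 2 C.n))) :=
    (dist_lt_two_pow hn hβ v r).trans_le (Nat.pow_le_pow_right (by norm_num) (by omega))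
  have h := pair_lt_two_pow hd (pair_lt_two_pow htag' (pair_lt_two_pow ha hb))
  exact h.trans_eq (by ring)

end Bounds

/-- If the verifier accepts, then some node finds an error in the refutation. -/
lemma exists_not_refutes_of_forall_verifies {C : Config} {ident : Fin C.n → ℕ}
    {ℓ₁ ℓ₂ ℓ₃ : Fin C.n → List Bool}
    (h : ∀ v, Verifies (nodeData C ident (labels C ℓ₁ ℓ₂ ℓ₃) v)
      (nbrData C ident (labels C ℓ₁ ℓ₂ ℓ₃) v)) :
    ∃ v, ¬ Refutes (nodeData C ident (labels C ℓ₁ ℓ₂ ℓ₃) v)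
      (nbrData C ident (labels C ℓ₁ ℓ₂ ℓ₃) v) := by
  have : Nonempty (Fin C.n) := ⟨⟨0, C.npos⟩⟩
  obtain ⟨v, hv⟩ := Finite.exists_min fun v => decodeBits (ℓ₃ v)
  obtain ⟨-, -, h0 | h1⟩ := h v
  · exact ⟨v, h0.2⟩
  · simp only [exists_mem_nbrData, nodeData_level] at h1
    obtain ⟨w, -, hw⟩ := h1
    exact absurd (hv w) hw.not_ge

/-- If some node finds an error in the refutation, then a last labelling makes the verifier
accept. -/
lemma exists_forall_verifies {C : Config} {β : ℕ} {ident : Fin C.n → ℕ}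
    {ℓ₁ ℓ₂ : Fin C.n → List Bool} (hn : 2 ≤ C.n) (hβ : 1 ≤ β) (hx : ∀ v, C.x v = [])
    {r : Fin C.n}
    (hr : ∀ ℓ₃, ¬ Refutes (nodeData C ident (labels C ℓ₁ ℓ₂ ℓ₃) r)
      (nbrData C ident (labels C ℓ₁ ℓ₂ ℓ₃) r)) :
    ∃ ℓ₃, goodLabel (16 * β) C ℓ₃ ∧ ∀ v, Verifies (nodeData C ident (labels C ℓ₁ ℓ₂ ℓ₃) v)
      (nbrData C ident (labels C ℓ₁ ℓ₂ ℓ₃) v) := by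
  refine ⟨fun v => (C.G.dist v r).bits, goodLabel_mono (by omega)
    (goodLabel_bits_of_lt fun v => dist_lt_two_pow hn hβ v r), fun v => ⟨hx v, ?_, ?_⟩⟩
  · have : Nontrivial (Fin C.n) := Fin.nontrivial_iff_two_le.2 hn
    rw [nbrData_nonempty]
    exact C.conn.preconnected.exists_adj_of_nontrivial v
  · by_cases hv : v = r
    · subst hv
      exact Or.inl ⟨by simp [decodeBits], hr _⟩
    · right
      simpa [decodeBits_bits] using C.conn.exists_adj_dist_lt hv

/-- No refutation of a nontrivial automorphism is accepted by all nodes. -/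
lemma exists_not_refutes_of_automorphism {C : Config} {ident : Fin C.n → ℕ}
    (hinj : Function.Injective ident) {φ : Fin C.n ≃ Fin C.n} (hφ : φ ≠ Equiv.refl _)
    (hadj : ∀ u v, C.G.Adj u v ↔ C.G.Adj (φ u) (φ v)) (ℓ₂ ℓ₃ : Fin C.n → List Bool) :
    ∃ v, ¬ Refutes (nodeData C ident (labels C (fun v => (ident (φ v)).bits) ℓ₂ ℓ₃) v)
      (nbrData C ident (labels C (fun v => (ident (φ v)).bits) ℓ₂ ℓ₃) v) := by
  by_contra! h
  simp only [Refutes, LocalClaim, exists_mem_nbrData, forall_mem_nbrData, nodeData_claim,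
    nodeData_depth, nodeData_ident, nodeData_image, decodeBits_bits] at h
  have : Nonempty (Fin C.n) := ⟨⟨0, C.npos⟩⟩
  obtain ⟨r, hr⟩ := Finite.exists_min fun v => (decodeBits (ℓ₂ v)).unpair.1
  have hconst := fun v => C.conn.apply_eq_of_forall_adj (fun u v huv => (h u).1 v huv) v r
  have hr0 : (decodeBits (ℓ₂ r)).unpair.1 = 0 := by
    obtain h0 | ⟨w, -, hw⟩ := (h r).2.1
    · exact h0
    · exact absurd (hr w) hw.not_ge
  have hc := fun v => (h v).2.2
  simp only [hconst] at hc
  obtain ht | ht | ht : (decodeBits (ℓ₂ r)).unpair.2.unpair.1 = 0 ∨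
      (decodeBits (ℓ₂ r)).unpair.2.unpair.1 = 1 ∨
      2 ≤ (decodeBits (ℓ₂ r)).unpair.2.unpair.1 := by omega
  · exact hφ (Equiv.ext fun v => hinj ((hc v).1 ht))
  · refine ((hc (φ.symm r)).2.1 ht).1 ?_
    rw [φ.apply_symm_apply]
    exact ((hc r).2.1 ht).2 hr0
  · obtain ⟨ha, w, hw, hb⟩ := ((hc r).2.2 ht).2 hr0
    exact ((hc (φ r)).2.2 ht).1 ⟨ha, φ w, (hadj r w).1 hw, hb⟩

/-- If the refutation with triple `(tag, a, b)` and root `r` fails, then it fails at a node where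
its meaning is violated. -/
lemma exists_not_localClaim {C : Config} {ident : Fin C.n → ℕ} {ℓ₁ ℓ₃ : Fin C.n → List Bool}
    {tag a b : ℕ} {r : Fin C.n}
    (h : ∃ v, ¬ Refutes (nodeData C ident (labels C ℓ₁ (refutation C tag a b r) ℓ₃) v)
      (nbrData C ident (labels C ℓ₁ (refutation C tag a b r) ℓ₃) v)) :
    ∃ v, ¬ LocalClaim tag a b (nodeData C ident (labels C ℓ₁ (refutation C tag a b r) ℓ₃) v)
      (nbrData C ident (labels C ℓ₁ (refutation C tag a b r) ℓ₃) v) := by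
  obtain ⟨v, hv⟩ := h
  refine ⟨v, fun hclaim => hv ⟨?_, ?_, ?_⟩⟩
  · simp [refutation, decodeBits_bits]
  · by_cases hvr : v = r
    · left
      simp [refutation, decodeBits_bits, hvr]
    · right
      simpa [refutation, decodeBits_bits] using C.conn.exists_adj_dist_lt hvr
  · simpa [refutation, decodeBits_bits, encodeClaim] using hclaim

/-- If every short refutation fails, then the first labelling encodes a nontrivial
automorphism. -/
lemma exists_automorphism {C : Config} {β : ℕ} {ident : Fin C.n → ℕ}
    {ℓ₁ : Fin C.n → List Bool} (hn : 2 ≤ C.n) (hβ : 1 ≤ β) (hid : IsIdAssignment β C ident)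
    (h : ∀ ℓ₂, goodLabel (16 * β) C ℓ₂ → ∃ ℓ₃, ∃ v,
      ¬ Refutes (nodeData C ident (labels C ℓ₁ ℓ₂ ℓ₃) v)
        (nbrData C ident (labels C ℓ₁ ℓ₂ ℓ₃) v)) :
    ∃ φ : Fin C.n ≃ Fin C.n, φ ≠ Equiv.refl (Fin C.n) ∧
      ∀ u v : Fin C.n, C.G.Adj u v ↔ C.G.Adj (φ u) (φ v) := by
  have hfail : ∀ tag a b r, tag ≤ 2 → a < 2 ^ (2 * β * Nat.log 2 C.n) →
      b < 2 ^ (2 * β * Nat.log 2 C.n) → ∃ v, ¬ ((tag = 0 → decodeBits (ℓ₁ v) = ident v) ∧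
        (tag = 1 → decodeBits (ℓ₁ v) ≠ a ∧ (v = r → ident v = a)) ∧
        (2 ≤ tag → ¬ (ident v = a ∧ ∃ w, C.G.Adj v w ∧ ident w = b) ∧
          (v = r → decodeBits (ℓ₁ v) = a ∧
            ∃ w, C.G.Adj v w ∧ decodeBits (ℓ₁ w) = b))) := by
    intro tag a b r ht ha hb
    obtain ⟨ℓ₃, hv⟩ := h _ (goodLabel_refutation hn hβ ht ha hb r)
    obtain ⟨v, hv⟩ := exists_not_localClaim hv
    refine ⟨v, ?_⟩
    simpa only [LocalClaim, exists_mem_nbrData, nodeData_depth, nodeData_ident, nodeData_image,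
      refutation, decodeBits_bits, Nat.unpair_pair, C.conn.dist_eq_zero_iff] using hv
  have hlt := ident_lt_two_pow hn hβ hid
  have hsurj : ∀ r, ∃ v, decodeBits (ℓ₁ v) = ident r := by
    intro r
    by_contra! hne
    obtain ⟨v, hv⟩ := hfail 1 (ident r) (ident r) r (by omega) (hlt r) (hlt r)
    refine hv ⟨by omega, fun _ => ⟨hne v, ?_⟩, by omega⟩
    rintro rfl
    rfl
  choose g hg using hsurj
  have hginj : Function.Injective g := fun u v huv => hid.1 (by rw [← hg, huv, hg])
  let γ : Fin C.n ≃ Fin C.n := Equiv.ofBijective g (Finite.injective_iff_bijective.1 hginj)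
  have himage : ∀ v, decodeBits (ℓ₁ v) = ident (γ.symm v) := by
    intro v
    rw [← hg]
    exact congrArg (fun w => decodeBits (ℓ₁ w)) (γ.apply_symm_apply v).symm
  simp only [himage] at hfail
  have hmap : ∀ u v, C.G.Adj u v → C.G.Adj (γ.symm u) (γ.symm v) := by
    intro u w huw
    by_contra hne
    obtain ⟨v, hv⟩ := hfail 2 (ident (γ.symm u)) (ident (γ.symm w)) u le_rfl (hlt _) (hlt _)
    refine hv ⟨by omega, by omega, fun _ => ⟨?_, ?_⟩⟩
    · rintro ⟨h1, w', hw', h2⟩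
      rw [hid.1 h1, hid.1 h2] at hw'
      exact hne hw'
    · rintro rfl
      exact ⟨rfl, w, huw, rfl⟩
  refine ⟨γ.symm, fun hrefl => ?_, fun u v => ⟨hmap u v, SimpleGraph.adj_of_adj_perm hmap⟩⟩
  obtain ⟨v, hv⟩ := hfail 0 0 0 ⟨0, C.npos⟩ (by omega) (by positivity) (by positivity)
  exact hv ⟨fun _ => by rw [hrefl]; rfl, by omega, by omega⟩


/-- `NONTRIVIAL-AUTOMORPHISM ∈ Λ_3`. -/
theorem nta_in_Lambda3 (α β : ℕ) (hα : 1 ≤ α) (hβ : 1 ≤ β) :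
    LambdaC α β 3 NTALang := by
  rw [LambdaC, if_pos (by norm_num)]
  refine ⟨LocalAlg.ofNeighbors Verifies, 16 * β, fun C _ ident hid => ?_⟩
  rw [altQ_three_ofNeighbors]
  constructor
  · rintro ⟨hx, φ, hφ, hadj⟩
    have hn : 2 ≤ C.n := by
      by_contra! hlt
      have : Subsingleton (Fin C.n) := Fin.subsingleton_iff_le_one.2 (by omega)
      exact hφ (Subsingleton.elim _ _)
    refine ⟨fun v => (ident (φ v)).bits, goodLabel_mono (by omega)
      (goodLabel_bits_of_lt fun v => ident_lt_two_pow hn hβ hid (φ v)), fun ℓ₂ _ => ?_⟩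
    obtain ⟨r, hr⟩ := exists_not_refutes_of_automorphism hid.1 hφ hadj ℓ₂ ℓ₂
    exact exists_forall_verifies hn hβ hx fun ℓ₃ => fun h => hr (refutes_congr.1 h)
  · rintro ⟨ℓ₁, -, h⟩
    obtain ⟨ℓ₃, -, hver⟩ := h (fun _ => []) fun v => by simp
    obtain ⟨w, hw⟩ := (nbrData_nonempty C ident ⟨0, C.npos⟩).1 (hver ⟨0, C.npos⟩).2.1
    have hn : 2 ≤ C.n := Fin.nontrivial_iff_two_le.1 ⟨_, _, hw.ne⟩
    refine ⟨fun v => (hver v).1, exists_automorphism hn hβ hid (ℓ₁ := ℓ₁) fun ℓ₂ hℓ₂ => ?_⟩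
    obtain ⟨ℓ₃, -, hver⟩ := h ℓ₂ hℓ₂
    exact ⟨ℓ₃, exists_not_refutes_of_forall_verifies hver⟩
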